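/- arXiv:2211.02954 — 2 statements merged into one kernel-verified Lean document; each statement's English description precedes it below -/
import Mathlib

section
/- Let q ≥ 1, α = (α_1,…,α_q) with each α_i a positive rational number, and β = (β_1,…,β_q) ∈ ℂ^q with Re(β_i) > 0 for all i. Write α_i = m_i/n_i in lowest terms, let L = lcm(n_1,…,n_q), k_i = α_i·L (a positive integer), and d_F = 2∑_{i=1}^q α_i. Set C₁ = L·d_F / (2·(∏_{i=1}^q k_i^{k_i})^{2/(L·d_F)}), C₂ = 2/d_F, C₃ = ∑_{i=1}^q conj(β_i) + (1−q)/2, and C₄ = max{0, C₂ − 1}. Then Z̃_{α,β} is differentiable on (0,∞) and there exist constants C > 0 and x₀ > 0 such that for all x ≥ x₀, |Z̃′_{α,β}(x)| ≤ C · exp(−C₁ · x^{C₂}) · x^{C₂·Re(C₃) + C₄}, where Z̃′_{α,β} denotes the derivative of Z̃_{α,β} with respect to its argument. -/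
open Complex MeasureTheory Filter Topology Finset

noncomputable section

/-- The vertical line integral `(1/(2πi)) ∫_{Re s = c} (∏ i, Γ(αᵢ s + Bᵢ)) x^{-s} ds`,
parametrized by `s = c + it`. -/
def VI {q : ℕ} (α : Fin q → ℝ) (B : Fin q → ℂ) (c : ℝ) (x : ℝ) : ℂ :=
  (2 * (Real.pi : ℂ) * Complex.I)⁻¹ *
    ∫ t : ℝ, Complex.I *
      ((∏ i, Complex.Gamma ((α i : ℂ) * ((c : ℂ) + (t : ℂ) * Complex.I) + B i)) *
        (x : ℂ) ^ (-((c : ℂ) + (t : ℂ) * Complex.I)))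

/-- The abscissa `c_F`: `min_i 1/(2αᵢ)` if all `Re βᵢ = 0`, and `min_i Re βᵢ/αᵢ` otherwise. -/
def cFval {q : ℕ} (α : Fin q → ℝ) (β : Fin q → ℂ) : ℝ :=
  if ∀ i, (β i).re = 0 then ⨅ i, 1 / (2 * α i) else ⨅ i, (β i).re / α i

/-- Axioms (i)–(iv) of the Selberg class for `F` with Dirichlet coefficients `a` and
data `(Q, α, β, ω)`. -/
def SelbergAxioms (F : ℂ → ℂ) (a : ℕ → ℂ) (Q : ℝ) {q : ℕ} (α : Fin q → ℝ)
    (β : Fin q → ℂ) (ω : ℂ) : Prop :=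
  1 ≤ q ∧ 0 < Q ∧ (∀ i, 0 < α i) ∧ (∀ i, 0 ≤ (β i).re) ∧ ‖ω‖ = 1 ∧
  -- (i) Dirichlet series, absolutely convergent for Re s > 1, with a(1) = 1
  a 1 = 1 ∧
  (∀ s : ℂ, 1 < s.re →
    Summable (fun n : ℕ => ‖a (n + 1) / ((n : ℂ) + 1) ^ s‖) ∧
    HasSum (fun n : ℕ => a (n + 1) / ((n : ℂ) + 1) ^ s) (F s)) ∧
  -- (ii) analytic continuation: (s-1)^m F(s) extends to an entire function of finite order
  (∃ (m : ℕ) (G : ℂ → ℂ) (C r : ℝ), Differentiable ℂ G ∧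
    (∀ s, ‖G s‖ ≤ C * Real.exp (‖s‖ ^ r)) ∧ ∀ s, s ≠ 1 → G s = (s - 1) ^ m * F s) ∧
  -- (iii) functional equation Φ(s) = ω conj(Φ(1 - conj s))
  (∀ s : ℂ, (Q : ℂ) ^ s * F s * ∏ i, Complex.Gamma ((α i : ℂ) * s + β i) =
    ω * (starRingEnd ℂ) ((Q : ℂ) ^ (1 - (starRingEnd ℂ) s) * F (1 - (starRingEnd ℂ) s) *
      ∏ i, Complex.Gamma ((α i : ℂ) * (1 - (starRingEnd ℂ) s) + β i))) ∧
  -- (iv) Euler product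
  (∃ (g : ℕ → ℂ) (C₀ θ : ℝ), θ < 1 / 2 ∧
    (∀ p k : ℕ, p.Prime → 1 ≤ k → ‖g (p ^ k)‖ ≤ C₀ * (p : ℝ) ^ ((k : ℝ) * θ)) ∧
    (∀ s : ℂ, 1 < s.re → HasProd
      (fun p : Nat.Primes =>
        Complex.exp (∑' j : ℕ, g ((p : ℕ) ^ (j + 1)) / ((p : ℕ) : ℂ) ^ (((j : ℂ) + 1) * s)))
      (F s)))

/-- The extra axioms of the class `S*`: rational `αᵢ`, a polynomial Euler product, and
the Ramanujan hypothesis. -/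
def SStarAxioms (F : ℂ → ℂ) (a : ℕ → ℂ) {q : ℕ} (α : Fin q → ℝ) : Prop :=
  (∀ i, ∃ r : ℚ, α i = (r : ℝ)) ∧
  (∃ (N : ℕ) (γ : Nat.Primes → Fin N → ℂ), ∀ s : ℂ, 1 < s.re →
    HasProd (fun p : Nat.Primes => ∏ i, (1 - γ p i / ((p : ℕ) : ℂ) ^ s)⁻¹) (F s)) ∧
  (∀ ε : ℝ, 0 < ε → ∃ C : ℝ, ∀ n : ℕ, 1 ≤ n → ‖a n‖ ≤ C * (n : ℝ) ^ ε)

/-- On the right half-plane `|Γ(z)| ≤ Γ(Re z)`. -/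
lemma norm_Gamma_le_Gamma_re {z : ℂ} (hz : 0 < z.re) : ‖Complex.Gamma z‖ ≤ Real.Gamma z.re := by
  rw [Complex.Gamma_eq_integral hz, Real.Gamma_eq_integral hz, Complex.GammaIntegral]
  refine (norm_integral_le_integral_norm _).trans (le_of_eq ?_)
  refine setIntegral_congr_fun measurableSet_Ioi fun x hx => ?_
  have hx : 0 < x := hx
  simp [Complex.norm_cpow_eq_rpow_re_of_pos hx, Complex.norm_exp]

lemma Gamma_add_nat_eq_prod {z : ℂ} (hz : 0 < z.re) (M : ℕ) :
    Complex.Gamma (z + M) = (∏ n ∈ range M, (z + n)) * Complex.Gamma z := by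
  induction M with
  | zero => simp
  | succ M ih =>
    have hne : z + M ≠ 0 := by
      intro h
      have := congrArg Complex.re h
      simp at this
      linarith [M.cast_nonneg (α := ℝ)]
    rw [Nat.cast_succ, ← add_assoc, Complex.Gamma_add_one _ hne, ih, prod_range_succ]
    ring

lemma real_Gamma_add_nat_eq_prod {y : ℝ} (hy : 0 < y) (M : ℕ) :
    Real.Gamma (y + M) = (∏ n ∈ range M, (y + n)) * Real.Gamma y := by
  have h := Gamma_add_nat_eq_prod (z := (y : ℂ)) (by simpa using hy) M
  rw [Complex.Gamma_ofReal, ← Complex.ofReal_natCast, ← Complex.ofReal_add,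
    Complex.Gamma_ofReal] at h
  exact_mod_cast h

/-- Decay of `Γ` on vertical lines, at the Gaussian scale near the real axis. -/
lemma norm_Gamma_mul_rpow_le {z : ℂ} (hz : 0 < z.re) :
    ‖Complex.Gamma z‖ * √(1 + z.im ^ 2 / (4 * z.re ^ 2)) ^ z.re ≤ Real.Gamma z.re := by
  set σ := z.re
  set r := √(1 + z.im ^ 2 / (4 * σ ^ 2)) with hr
  have hr1 : 1 ≤ r := by
    rw [hr, Real.one_le_sqrt]
    have : 0 ≤ z.im ^ 2 / (4 * σ ^ 2) := by positivity
    linarith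
  set M := ⌈σ⌉₊ with hM
  have hfac : ∀ n ∈ range M, r * (σ + n) ≤ ‖z + n‖ := by
    intro n hn
    have hnσ : (n : ℝ) < σ := Nat.lt_ceil.mp (mem_range.mp hn)
    rw [Complex.norm_def, Complex.normSq_apply]
    apply Real.le_sqrt_of_sq_le
    rw [mul_pow, hr, Real.sq_sqrt (by positivity)]
    have h1 : (σ + n) ^ 2 ≤ 4 * σ ^ 2 := by nlinarith [n.cast_nonneg (α := ℝ)]
    have h2 : z.im ^ 2 / (4 * σ ^ 2) * (σ + n) ^ 2 ≤ z.im ^ 2 := by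
      rw [div_mul_eq_mul_div, div_le_iff₀ (by positivity)]
      gcongr
    simp only [Complex.add_re, Complex.natCast_re, Complex.add_im, Complex.natCast_im, add_zero]
    change _ ≤ (σ + n) * (σ + n) + _
    nlinarith
  have hprod : r ^ M * ∏ n ∈ range M, (σ + n) ≤ ∏ n ∈ range M, ‖z + n‖ := by
    have := prod_le_prod (fun n _ => by positivity) hfac
    rwa [prod_mul_distrib, prod_const, card_range] at this
  have hP : 0 < ∏ n ∈ range M, (σ + (n : ℝ)) := prod_pos fun n _ => by positivity
  have hG := norm_Gamma_le_Gamma_re (z := z + M) (by simp; positivity)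
  rw [Gamma_add_nat_eq_prod hz, norm_mul, norm_prod] at hG
  have hre : (z + M).re = σ + M := by simp [σ]
  rw [hre, real_Gamma_add_nat_eq_prod hz] at hG
  have h3 : ‖Complex.Gamma z‖ * r ^ M ≤ Real.Gamma σ := by
    refine le_of_mul_le_mul_left ?_ hP
    refine le_trans ?_ hG
    calc _ = (r ^ M * ∏ n ∈ range M, (σ + (n : ℝ))) * ‖Complex.Gamma z‖ := by ring
      _ ≤ _ := by gcongr
  refine le_trans ?_ h3
  gcongr
  rw [← Real.rpow_natCast]
  exact Real.rpow_le_rpow_of_exponent_le hr1 (Nat.le_ceil σ)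

lemma sqrt_mul_norm_Gamma_le {z : ℂ} (hz : 3 ≤ z.re) :
    √(1 + z.im ^ 2 / (4 * z.re ^ 2)) * ‖Complex.Gamma z‖ ≤
      Real.Gamma z.re * (1 + (z.im / (4 * √z.re)) ^ 2)⁻¹ := by
  have hz0 : 0 < z.re := by linarith
  have h := norm_Gamma_mul_rpow_le hz0
  set σ := z.re
  set y := z.im ^ 2 / (4 * σ ^ 2) with hy
  have hy0 : 0 ≤ y := by positivity
  have hr : 0 < √(1 + y) := by positivity
  have hpow : √(1 + y) ^ (σ - 1) = (1 + y) ^ ((σ - 1) / 2) := by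
    rw [Real.sqrt_eq_rpow, ← Real.rpow_mul (by positivity)]
    ring_nf
  have hB : 1 + (z.im / (4 * √σ)) ^ 2 ≤ √(1 + y) ^ (σ - 1) := by
    rw [hpow]
    refine le_trans ?_ (one_add_mul_self_le_rpow_one_add (by linarith) (by linarith))
    rw [div_pow, mul_pow, Real.sq_sqrt hz0.le, hy, div_mul_div_comm, add_le_add_iff_left,
      div_le_div_iff₀ (by positivity) (by positivity)]
    nlinarith [mul_nonneg (mul_nonneg (sq_nonneg z.im) hz0.le) (by linarith : 0 ≤ σ - 3),
      mul_nonneg (sq_nonneg z.im) hz0.le]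
  rw [← div_eq_mul_inv, le_div_iff₀ (by positivity)]
  refine le_trans ?_ h
  calc _ ≤ √(1 + y) * ‖Complex.Gamma z‖ * √(1 + y) ^ (σ - 1) := by gcongr
    _ = ‖Complex.Gamma z‖ * (√(1 + y) ^ (σ - 1) * √(1 + y) ^ (1 : ℝ)) := by
      rw [Real.rpow_one]; ring
    _ = _ := by rw [← Real.rpow_add hr]; ring_nf

lemma norm_mul_norm_Gamma_affine_le {a : ℝ} (ha : 0 < a) (b s : ℂ)
    (hσ : 3 ≤ (a * s + b).re) :
    ‖s‖ * ‖Complex.Gamma (a * s + b)‖ ≤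
      (2 + ‖b‖) / a * ((a * s + b).re * Real.Gamma (a * s + b).re) *
        (1 + ((a * s + b).im / (4 * √(a * s + b).re)) ^ 2)⁻¹ := by
  have h := sqrt_mul_norm_Gamma_le hσ
  have hs : a * ‖s‖ ≤ ‖(a : ℂ) * s + b‖ + ‖b‖ := by
    have := norm_sub_le ((a : ℂ) * s + b) b
    rwa [add_sub_cancel_right, norm_mul, Complex.norm_real, Real.norm_of_nonneg ha.le] at this
  set z := (a : ℂ) * s + b
  set r := √(1 + z.im ^ 2 / (4 * z.re ^ 2)) with hr
  have hr1 : 1 ≤ r := by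
    rw [hr, Real.one_le_sqrt]
    have : 0 ≤ z.im ^ 2 / (4 * z.re ^ 2) := by positivity
    linarith
  have hz0 : 0 < z.re := by linarith
  have hzn : ‖z‖ ≤ 2 * z.re * r := by
    rw [Complex.norm_def, Complex.normSq_apply, Real.sqrt_le_left (by positivity), mul_pow, hr,
      Real.sq_sqrt (by positivity), mul_add, mul_div_assoc', mul_comm ((2 * z.re) ^ 2) (z.im ^ 2),
      show (2 * z.re) ^ 2 = 4 * z.re ^ 2 by ring, mul_div_cancel_right₀ _ (by positivity)]
    nlinarith [sq_nonneg z.re]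
  have hsb : ‖s‖ ≤ (2 + ‖b‖) / a * z.re * r := by
    rw [div_mul_eq_mul_div, div_mul_eq_mul_div, le_div_iff₀ ha]
    have : ‖b‖ ≤ ‖b‖ * (z.re * r) := le_mul_of_one_le_right (norm_nonneg _) (by nlinarith)
    nlinarith
  calc _ ≤ (2 + ‖b‖) / a * z.re * r * ‖Complex.Gamma z‖ := by gcongr
    _ = (2 + ‖b‖) / a * z.re * (r * ‖Complex.Gamma z‖) := by ring
    _ ≤ (2 + ‖b‖) / a * z.re *
        (Real.Gamma z.re * (1 + (z.im / (4 * √z.re)) ^ 2)⁻¹) := by gcongr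
    _ = _ := by ring

/-- Stirling's upper bound for `Γ` on `[1, ∞)`. -/
lemma log_Gamma_le {y : ℝ} (hy : 1 ≤ y) :
    Real.log (Real.Gamma y) ≤ (y - 1 / 2) * Real.log y - y + 2 := by
  set n := ⌊y⌋₊ with hn
  have hn1 : 1 ≤ n := Nat.le_floor (by simpa using hy)
  have hny : (n : ℝ) ≤ y := Nat.floor_le (by linarith)
  have hyn : y < n + 1 := Nat.lt_floor_add_one y
  have hn0 : (0 : ℝ) < n := by exact_mod_cast hn1
  have hfac : Real.log (n.factorial) ≤ (n + 1 / 2) * Real.log n - n + 1 := by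
    obtain ⟨m, hm⟩ : ∃ m, n = m + 1 := ⟨n - 1, by omega⟩
    have h := Stirling.log_stirlingSeq'_antitone (Nat.zero_le m)
    simp only [Function.comp_apply, Nat.succ_eq_add_one, zero_add] at h
    rw [← hm, Stirling.log_stirlingSeq_formula, Stirling.log_stirlingSeq_formula,
      Real.log_div hn0.ne' (Real.exp_pos 1).ne', Real.log_mul two_ne_zero hn0.ne',
      Real.log_exp] at h
    simp at h
    linarith
  have hGn : Real.log (Real.Gamma n) = Real.log n.factorial - Real.log n := by
    have h := Real.Gamma_add_one hn0.ne'
    rw [Real.Gamma_nat_eq_factorial] at h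
    rw [h, Real.log_mul hn0.ne' (Real.Gamma_pos_of_pos hn0).ne']
    ring
  have hGy : Real.log (Real.Gamma y) ≤ Real.log (Real.Gamma n) + (y - n) * Real.log n := by
    have h := Real.convexOn_log_Gamma.2 (Set.mem_Ioi.mpr hn0)
      (Set.mem_Ioi.mpr (by positivity : (0 : ℝ) < n + 1))
      (by linarith : 0 ≤ 1 - (y - n)) (by linarith : 0 ≤ y - n) (by ring)
    simp only [smul_eq_mul, Function.comp_apply] at h
    rw [Real.Gamma_add_one hn0.ne', Real.log_mul hn0.ne' (Real.Gamma_pos_of_pos hn0).ne',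
      show (1 - (y - n)) * (n : ℝ) + (y - n) * (n + 1) = y by ring] at h
    linarith
  have hlog : Real.log n ≤ Real.log y := Real.log_le_log hn0 hny
  nlinarith

lemma exists_log_Gamma_add_le {u : ℝ} (hu : 0 ≤ u) : ∃ K, ∀ D : ℝ, 1 ≤ D →
    Real.log (Real.Gamma (D + u)) ≤ (D + u - 1 / 2) * Real.log D - D + K := by
  refine ⟨u * (1 + u) + 2, fun D hD => ?_⟩
  have h := log_Gamma_le (y := D + u) (by linarith)
  have hD0 : 0 < D := by linarith
  have hl : Real.log (D + u) ≤ Real.log D + u / D := by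
    have h1 : D + u = D * (1 + u / D) := by field_simp
    rw [h1, Real.log_mul hD0.ne' (by positivity)]
    have := Real.log_le_sub_one_of_pos (x := 1 + u / D) (by positivity)
    linarith
  have h2 : (D + u - 1 / 2) * (u / D) ≤ u * (1 + u) := by
    rw [mul_div_assoc', div_le_iff₀ hD0]
    nlinarith [mul_nonneg hu hu, mul_nonneg (mul_nonneg hu hu) (by linarith : 0 ≤ D - 1)]
  have h3 := mul_le_mul_of_nonneg_left hl (by linarith : 0 ≤ D + u - 1 / 2)
  linarith

/-- Differentiation of an inverse Mellin integral under the integral sign. -/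
lemma exists_hasDerivAt_integral_cpow {g : ℝ → ℂ} (hg : Continuous g) {d : ℝ} (hd : 0 < d)
    {w : ℝ → ℝ} (hw : Integrable w) (hgw : ∀ t : ℝ, ‖(d : ℂ) + t * I‖ * ‖g t‖ ≤ w t)
    {x : ℝ} (hx : 0 < x) :
    ∃ D : ℂ, ‖D‖ ≤ x ^ (-d - 1) * ∫ t, w t ∧
      HasDerivAt (fun y : ℝ => ∫ t : ℝ, I * (g t * (y : ℂ) ^ (-((d : ℂ) + t * I)))) D x := by
  let F' : ℝ → ℝ → ℂ := fun y t =>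
    I * (g t * (-((d : ℂ) + t * I) * (y : ℂ) ^ (-((d : ℂ) + t * I) - 1)))
  have hF'norm : ∀ y : ℝ, 0 < y → ∀ t, ‖F' y t‖ ≤ y ^ (-d - 1) * w t := by
    intro y hy t
    simp only [F', norm_mul, norm_I, one_mul, norm_neg, norm_cpow_eq_rpow_re_of_pos hy]
    have : (-((d : ℂ) + t * I) - 1).re = -d - 1 := by simp
    rw [this]
    have := mul_le_mul_of_nonneg_right (hgw t) (Real.rpow_nonneg hy.le (-d - 1))
    linarith
  have hcont : ∀ y : ℝ, 0 < y → Continuous fun t : ℝ =>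
      I * (g t * (y : ℂ) ^ (-((d : ℂ) + t * I))) := by
    intro y hy
    have hy' : (y : ℂ) ≠ 0 := by exact_mod_cast hy.ne'
    refine continuous_const.mul (hg.mul ?_)
    exact Continuous.const_cpow (by fun_prop) (Or.inl hy')
  have hcont' : Continuous (F' x) := by
    have hy' : (x : ℂ) ≠ 0 := by exact_mod_cast hx.ne'
    refine continuous_const.mul (hg.mul (Continuous.mul (by fun_prop) ?_))
    exact Continuous.const_cpow (by fun_prop) (Or.inl hy')
  have hint : Integrable fun t : ℝ => I * (g t * (x : ℂ) ^ (-((d : ℂ) + t * I))) := by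
    refine (hw.const_mul (x ^ (-d) / d)).mono' (hcont x hx).aestronglyMeasurable
      (ae_of_all _ fun t => ?_)
    simp only [norm_mul, norm_I, one_mul, norm_cpow_eq_rpow_re_of_pos hx]
    have h1 : (-((d : ℂ) + t * I)).re = -d := by simp
    have h2 : d ≤ ‖(d : ℂ) + t * I‖ := by
      simpa using Complex.re_le_norm ((d : ℂ) + t * I)
    have h3 : d * ‖g t‖ ≤ w t := le_trans (by gcongr) (hgw t)
    rw [h1, div_mul_eq_mul_div, le_div_iff₀ hd]
    have := mul_le_mul_of_nonneg_right h3 (Real.rpow_nonneg hx.le (-d))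
    linarith
  have hmem : Set.Ioi (x / 2) ∈ 𝓝 x := Ioi_mem_nhds (by linarith)
  have hpos : ∀ y ∈ Set.Ioi (x / 2), 0 < y := fun y hy =>
    lt_trans (by positivity) (Set.mem_Ioi.mp hy)
  have hw0 : ∀ t, 0 ≤ w t := fun t => le_trans (by positivity) (hgw t)
  obtain ⟨hF'int, hder⟩ := hasDerivAt_integral_of_dominated_loc_of_deriv_le (μ := volume)
    (F := fun (y : ℝ) (t : ℝ) => I * (g t * (y : ℂ) ^ (-((d : ℂ) + t * I)))) (F' := F')
    (bound := fun t => (x / 2) ^ (-d - 1) * w t) hmem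
    (by filter_upwards [hmem] with y hy using (hcont y (hpos y hy)).aestronglyMeasurable)
    hint hcont'.aestronglyMeasurable
    (ae_of_all _ fun t y hy => (hF'norm y (hpos y hy) t).trans (by
      refine mul_le_mul_of_nonneg_right ?_ (hw0 t)
      exact Real.rpow_le_rpow_of_nonpos (by positivity) (le_of_lt hy) (by linarith)))
    (hw.const_mul _)
    (ae_of_all _ fun t y hy => by
      have hs : -((d : ℂ) + t * I) ≠ 0 := by
        intro h
        have := congrArg Complex.re h
        simp at this
        exact hd.ne' this
      exact ((hasDerivAt_ofReal_cpow_const (hpos y hy).ne' hs).const_mul (g t)).const_mul I)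
  refine ⟨_, ?_, hder⟩
  rw [← integral_const_mul]
  exact norm_integral_le_of_norm_le (hw.const_mul _) (ae_of_all _ (hF'norm x hx))

lemma integrable_inv_one_add_affine_sq {a R : ℝ} (ha : a ≠ 0) (hR : R ≠ 0) (v : ℝ) :
    Integrable fun t : ℝ => (1 + ((a * t + v) / R) ^ 2)⁻¹ := by
  have h := (integrable_inv_one_add_sq.comp_add_right (v / R)).comp_mul_left'
    (div_ne_zero ha hR)
  refine h.congr (ae_of_all _ fun t => ?_)
  simp only
  congr 3
  field_simp

lemma integral_inv_one_add_affine_sq {a R : ℝ} (ha : 0 < a) (hR : 0 < R) (v : ℝ) :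
    ∫ t : ℝ, (1 + ((a * t + v) / R) ^ 2)⁻¹ = R / a * Real.pi := by
  have h1 := Measure.integral_comp_mul_left (fun y : ℝ => (1 + (y + v / R) ^ 2)⁻¹) (a / R)
  rw [integral_add_right_eq_self (fun y : ℝ => (1 + y ^ 2)⁻¹) (v / R),
    integral_univ_inv_one_add_sq, inv_div, abs_of_pos (by positivity), smul_eq_mul] at h1
  rw [← h1]
  congr 1 with t
  congr 3
  field_simp

/-- The derivative of `VI`, bounded through the line of integration `Re s = d`, with a constant
independent of `d` and `x`. -/
lemma exists_hasDerivAt_VI {q : ℕ} {α : Fin q → ℝ} (hα : ∀ i, 0 < α i) {B : Fin q → ℂ}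
    (hB : ∀ i, 0 < (B i).re) (j : Fin q) {d : ℝ} (hd : 0 < d) (hσ : 3 ≤ α j * d + (B j).re)
    {x : ℝ} (hx : 0 < x) :
    ∃ D : ℂ, HasDerivAt (VI α B d) D x ∧
      ‖D‖ ≤ 2 * (2 + ‖B j‖) / α j ^ 2 * x ^ (-d - 1) *
        ((α j * d + (B j).re) * √(α j * d + (B j).re)) *
          ∏ i, Real.Gamma (α i * d + (B i).re) := by
  have hre : ∀ (i : Fin q) (t : ℝ),
      ((α i : ℂ) * ((d : ℂ) + t * I) + B i).re = α i * d + (B i).re := by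
    intro i t; simp
  have him : ∀ (i : Fin q) (t : ℝ),
      ((α i : ℂ) * ((d : ℂ) + t * I) + B i).im = α i * t + (B i).im := by
    intro i t; simp
  have hpos : ∀ i, 0 < α i * d + (B i).re := fun i =>
    add_pos (mul_pos (hα i) hd) (hB i)
  set σ := α j * d + (B j).re with hσdef
  set P := ∏ i, Real.Gamma (α i * d + (B i).re) with hP
  have hσ0 : 0 < σ := hpos j
  have hR : 0 < 4 * √σ := by positivity
  let g : ℝ → ℂ := fun t => ∏ i, Complex.Gamma ((α i : ℂ) * ((d : ℂ) + t * I) + B i)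
  have hg : Continuous g := by
    refine continuous_finsetProd _ fun i _ => continuous_iff_continuousAt.mpr fun t => ?_
    refine ContinuousAt.comp (g := Complex.Gamma)
      (f := fun t : ℝ => (α i : ℂ) * ((d : ℂ) + t * I) + B i) ?_ (by fun_prop)
    refine (Complex.differentiableAt_Gamma _ fun m hm => ?_).continuousAt
    have h := congrArg Complex.re hm
    rw [hre] at h
    simp only [neg_re, natCast_re] at h
    linarith [hpos i, m.cast_nonneg (α := ℝ)]
  have hgw : ∀ t : ℝ, ‖(d : ℂ) + t * I‖ * ‖g t‖ ≤
      (2 + ‖B j‖) / α j * (σ * P) * (1 + ((α j * t + (B j).im) / (4 * √σ)) ^ 2)⁻¹ := by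
    intro t
    have h1 := norm_mul_norm_Gamma_affine_le (hα j) (B j) ((d : ℂ) + t * I) (by rwa [hre])
    rw [hre, him, ← hσdef] at h1
    have h2 : ∏ i ∈ univ.erase j, ‖Complex.Gamma ((α i : ℂ) * ((d : ℂ) + t * I) + B i)‖ ≤
        ∏ i ∈ univ.erase j, Real.Gamma (α i * d + (B i).re) := by
      refine prod_le_prod (fun _ _ => norm_nonneg _) fun i _ => ?_
      have := norm_Gamma_le_Gamma_re (z := (α i : ℂ) * ((d : ℂ) + t * I) + B i)
        (by rw [hre]; exact hpos i)
      rwa [hre] at this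
    simp only [g, norm_prod]
    rw [← mul_prod_erase univ _ (mem_univ j), hP, ← mul_prod_erase univ _ (mem_univ j),
      ← mul_assoc, ← hσdef]
    refine (mul_le_mul h1 h2 (prod_nonneg fun _ _ => norm_nonneg _) ?_).trans (le_of_eq (by ring))
    exact le_trans (by positivity) h1
  have hw := (integrable_inv_one_add_affine_sq (hα j).ne' hR.ne' (B j).im).const_mul
    ((2 + ‖B j‖) / α j * (σ * P))
  obtain ⟨D, hD, hder⟩ := exists_hasDerivAt_integral_cpow hg hd hw hgw hx
  refine ⟨_, hder.const_mul ((2 * (Real.pi : ℂ) * I)⁻¹), ?_⟩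
  rw [integral_const_mul, integral_inv_one_add_affine_sq (hα j) hR] at hD
  rw [norm_mul, norm_inv, norm_mul, norm_mul, norm_I, Complex.norm_real, Complex.norm_two,
    Real.norm_of_nonneg Real.pi_pos.le, mul_one]
  have hα' := (hα j).ne'
  calc _ ≤ (2 * Real.pi)⁻¹ * (x ^ (-d - 1) *
        ((2 + ‖B j‖) / α j * (σ * P) * (4 * √σ / α j * Real.pi))) := by gcongr
    _ = _ := by field_simp; ring

/-- Stirling's bound for the integrand at the saddle point `d`, where
`∏ (α i * d) ^ α i = x`. -/
lemma exists_saddle_point_bound {q : ℕ} {α u : Fin q → ℝ} (hα : ∀ i, 0 < α i)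
    (hu : ∀ i, 0 ≤ u i) (j : Fin q) : ∃ K d₀ : ℝ, ∀ d x : ℝ, d₀ ≤ d → 0 < d → 0 < x →
      (∑ i, α i) * Real.log d + ∑ i, α i * Real.log (α i) = Real.log x →
      x ^ (-d - 1) * ((α j * d + u j) * √(α j * d + u j)) * ∏ i, Real.Gamma (α i * d + u i) ≤
        Real.exp (K + (∑ i, u i + (1 - q) / 2 + 1) * Real.log d - Real.log x
          - (∑ i, α i) * d) := by
  choose K hK using fun i => exists_log_Gamma_add_le (hu i)
  refine ⟨∑ i, ((u i - 1 / 2) * Real.log (α i) + K i) + 3 / 2 * Real.log (α j + u j),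
    max 1 (∑ i, 1 / α i), fun d x hd hd0 hx hdx => ?_⟩
  have hd1 : 1 ≤ d := (le_max_left _ _).trans hd
  have hD : ∀ i, 1 ≤ α i * d := by
    intro i
    have h1 : 1 / α i ≤ ∑ i, 1 / α i :=
      single_le_sum (f := fun i => 1 / α i) (fun i _ => (one_div_pos.mpr (hα i)).le) (mem_univ i)
    have h2 := (h1.trans (le_max_right 1 _)).trans hd
    rwa [div_le_iff₀ (hα i), mul_comm] at h2
  have hpos : ∀ i, 0 < α i * d + u i := fun i => by linarith [hD i, hu i]
  have hΓ : ∀ i ∈ univ, Real.Gamma (α i * d + u i) ≤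
      Real.exp ((α i * d + u i - 1 / 2) * Real.log (α i * d) - α i * d + K i) := by
    intro i _
    rw [← Real.log_le_iff_le_exp (Real.Gamma_pos_of_pos (hpos i))]
    exact hK i _ (hD i)
  have hprod := prod_le_prod (fun i _ => (Real.Gamma_pos_of_pos (hpos i)).le) hΓ
  rw [← Real.exp_sum] at hprod
  have hαu : 0 < α j + u j := by linarith [hα j, hu j]
  have hσ : (α j * d + u j) * √(α j * d + u j) ≤
      Real.exp (3 / 2 * Real.log (α j + u j) + 3 / 2 * Real.log d) := by
    rw [← Real.log_le_iff_le_exp (mul_pos (hpos j) (Real.sqrt_pos.mpr (hpos j))),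
      Real.log_mul (hpos j).ne' (Real.sqrt_pos.mpr (hpos j)).ne', Real.log_sqrt (hpos j).le]
    have h1 : Real.log (α j * d + u j) ≤ Real.log ((α j + u j) * d) :=
      Real.log_le_log (hpos j) (by nlinarith [hu j])
    rw [Real.log_mul hαu.ne' hd0.ne'] at h1
    linarith
  have hx' : x ^ (-d - 1) = Real.exp ((-d - 1) * Real.log x) := by
    rw [Real.rpow_def_of_pos hx, mul_comm]
  calc
    _ ≤ Real.exp ((-d - 1) * Real.log x) *
        Real.exp (3 / 2 * Real.log (α j + u j) + 3 / 2 * Real.log d) *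
        Real.exp (∑ i, ((α i * d + u i - 1 / 2) * Real.log (α i * d) - α i * d + K i)) := by
      rw [hx']
      gcongr
      exact prod_nonneg fun i _ => (Real.Gamma_pos_of_pos (hpos i)).le
    _ = _ := by
      rw [← Real.exp_add, ← Real.exp_add]
      congr 1
      have hsum : ∑ i, ((α i * d + u i - 1 / 2) * Real.log (α i * d) - α i * d + K i) =
          d * (∑ i, α i * Real.log (α i)) + d * Real.log d * (∑ i, α i)
            + Real.log d * (∑ i, u i) - q / 2 * Real.log d
            + ∑ i, ((u i - 1 / 2) * Real.log (α i) + K i) - (∑ i, α i) * d := by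
        have hq : (q : ℝ) / 2 * Real.log d = ∑ _i : Fin q, 1 / 2 * Real.log d := by
          rw [sum_const, card_univ, Fintype.card_fin, nsmul_eq_mul]
          ring
        rw [hq, mul_sum, mul_sum, mul_sum, sum_mul, ← sum_add_distrib, ← sum_add_distrib,
          ← sum_sub_distrib, ← sum_add_distrib, ← sum_sub_distrib]
        refine sum_congr rfl fun i _ => ?_
        rw [Real.log_mul (hα i).ne' hd0.ne']
        ring
      rw [hsum]
      linear_combination d * hdx

/-- The growth rate, rewritten in terms of the real parameters `α`. -/
lemma lcm_rate_eq {q : ℕ} {α : Fin q → ℝ} (hα : ∀ i, 0 < α i) (hμ : 0 < ∑ i, α i) {L : ℕ}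
    (hL : 0 < L) {k : Fin q → ℕ} (hk : ∀ i, (k i : ℝ) = α i * L) :
    (L : ℝ) * (2 * ∑ i, α i) /
      (2 * (∏ i, (k i : ℝ) ^ (k i)) ^ (2 / ((L : ℝ) * (2 * ∑ i, α i)))) =
      (∑ i, α i) * Real.exp (-(∑ i, α i * Real.log (α i)) / ∑ i, α i) := by
  set μ := ∑ i, α i with hμdef
  have hL' : (0 : ℝ) < L := by exact_mod_cast hL
  have hk0 : ∀ i, (0 : ℝ) < k i := fun i => by rw [hk]; exact mul_pos (hα i) hL'
  have hprod : ∏ i, (k i : ℝ) ^ (k i) =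
      Real.exp (L * (∑ i, α i * Real.log (α i) + μ * Real.log L)) := by
    rw [hμdef, sum_mul, ← sum_add_distrib, mul_sum, Real.exp_sum]
    refine prod_congr rfl fun i _ => ?_
    rw [← Real.exp_log (pow_pos (hk0 i) (k i)), Real.log_pow, hk,
      Real.log_mul (hα i).ne' hL'.ne']
    ring_nf
  have hpow : (∏ i, (k i : ℝ) ^ (k i)) ^ (2 / ((L : ℝ) * (2 * μ))) =
      Real.exp ((∑ i, α i * Real.log (α i)) / μ) * L := by
    rw [hprod, ← Real.exp_mul]
    conv_rhs => rw [← Real.exp_log hL', ← Real.exp_add]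
    congr 1
    field_simp
  rw [hpow, neg_div, Real.exp_neg]
  field_simp

/-- Exponential decay of the derivative `Z̃'_{α,β}(x)` as `x → ∞`, for rational `αᵢ > 0`
and `Re βᵢ > 0`. -/
theorem statement14 (q : ℕ) (hq : 1 ≤ q) (α : Fin q → ℚ) (hα : ∀ i, 0 < α i)
    (β : Fin q → ℂ) (hβ : ∀ i, 0 < (β i).re)
    (L : ℕ) (hL : L = (Finset.univ : Finset (Fin q)).lcm fun i => (α i).den)
    (k : Fin q → ℕ) (hk : ∀ i, (k i : ℚ) = α i * L)
    (dF : ℝ) (hdF : dF = 2 * ∑ i, (α i : ℝ))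
    (C₁ C₂ C₄ : ℝ) (C₃ : ℂ)
    (hC₁ : C₁ = (L : ℝ) * dF /
      (2 * (∏ i, (k i : ℝ) ^ (k i)) ^ (2 / ((L : ℝ) * dF))))
    (hC₂ : C₂ = 2 / dF)
    (hC₃ : C₃ = (∑ i, (starRingEnd ℂ) (β i)) + (1 - (q : ℂ)) / 2)
    (hC₄ : C₄ = max 0 (C₂ - 1))
    (Zt : ℝ → ℂ)
    (hZt : ∀ d : ℝ, 0 < d → ∀ x : ℝ, 0 < x →
      Zt x = VI (fun i => (α i : ℝ)) (fun i => (starRingEnd ℂ) (β i)) d x) :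
    (∀ x : ℝ, 0 < x → DifferentiableAt ℝ Zt x) ∧
    ∃ C x₀ : ℝ, 0 < C ∧ 0 < x₀ ∧ ∀ x : ℝ, x₀ ≤ x →
      ‖deriv Zt x‖ ≤ C * Real.exp (-C₁ * x ^ C₂) * x ^ (C₂ * C₃.re + C₄) := by
  obtain ⟨j⟩ : Nonempty (Fin q) := ⟨⟨0, hq⟩⟩
  set a : Fin q → ℝ := fun i => (α i : ℝ) with ha
  set B : Fin q → ℂ := fun i => (starRingEnd ℂ) (β i) with hBdef
  have ha0 : ∀ i, 0 < a i := fun i => Rat.cast_pos.mpr (hα i)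
  have hBre : ∀ i, (B i).re = (β i).re := fun i => by simp [hBdef]
  have hB0 : ∀ i, 0 < (B i).re := fun i => by rw [hBre]; exact hβ i
  set μ := ∑ i, a i with hμdef
  set S := ∑ i, a i * Real.log (a i) with hS
  have hμ : 0 < μ := sum_pos (fun i _ => ha0 i) ⟨j, mem_univ j⟩
  have hC₂μ : C₂ = 1 / μ := by rw [hC₂, hdF]; field_simp
  have hLpos : 0 < L := by
    rw [hL, Nat.pos_iff_ne_zero, Ne, Finset.lcm_eq_zero_iff]
    simp
  have hC₁μ : C₁ = μ * Real.exp (-S / μ) := by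
    rw [hC₁, hdF]
    exact lcm_rate_eq ha0 hμ hLpos fun i => by simp only [ha]; exact_mod_cast hk i
  have hC₃re : C₃.re = ∑ i, (B i).re + (1 - q) / 2 := by
    rw [hC₃, show (1 - (q : ℂ)) / 2 = (((1 - q) / 2 : ℝ) : ℂ) by push_cast; rfl, add_re,
      ofReal_re, re_sum]
  have key : ∀ d : ℝ, 3 / a j ≤ d → ∀ x : ℝ, 0 < x → ∃ D : ℂ, HasDerivAt Zt D x ∧
      ‖D‖ ≤ 2 * (2 + ‖B j‖) / a j ^ 2 * x ^ (-d - 1) *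
        ((a j * d + (B j).re) * √(a j * d + (B j).re)) *
          ∏ i, Real.Gamma (a i * d + (B i).re) := by
    intro d hd x hx
    have hd0 : 0 < d := lt_of_lt_of_le (div_pos three_pos (ha0 j)) hd
    have h3 : 3 ≤ a j * d + (B j).re := by
      rw [div_le_iff₀ (ha0 j)] at hd
      linarith [hB0 j]
    obtain ⟨D, hD, hDle⟩ := exists_hasDerivAt_VI ha0 hB0 j hd0 h3 hx
    refine ⟨D, hD.congr_of_eventuallyEq ?_, hDle⟩
    filter_upwards [Ioi_mem_nhds hx] with y hy using hZt d hd0 y hy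
  refine ⟨fun x hx => ?_, ?_⟩
  · obtain ⟨D, hD, -⟩ := key _ le_rfl x hx
    exact hD.differentiableAt
  obtain ⟨K, d₀, hK⟩ := exists_saddle_point_bound ha0 (fun i => (hB0 i).le) j
  have htend : Tendsto (fun x : ℝ => Real.exp ((Real.log x - S) / μ)) atTop atTop :=
    Real.tendsto_exp_atTop.comp
      ((tendsto_atTop_add_const_right _ _ Real.tendsto_log_atTop).atTop_div_const hμ)
  obtain ⟨x₁, hx₁⟩ := eventually_atTop.mp (htend.eventually_ge_atTop (max d₀ (3 / a j)))
  set T := 2 * (2 + ‖B j‖) / a j ^ 2 with hT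
  have hT0 : 0 < T := by have := ha0 j; positivity
  refine ⟨T * Real.exp (K - (C₃.re + 1) * (S / μ)), max 1 x₁, by positivity, by positivity,
    fun x hx => ?_⟩
  have hx1 : 1 ≤ x := (le_max_left _ _).trans hx
  have hx0 : 0 < x := by linarith
  have hdx := hx₁ x ((le_max_right _ _).trans hx)
  set d := Real.exp ((Real.log x - S) / μ) with hd
  have hd0 : 0 < d := Real.exp_pos _
  have hlogd : Real.log d = (Real.log x - S) / μ := Real.log_exp _
  obtain ⟨D, hD, hDle⟩ := key d ((le_max_right _ _).trans hdx) x hx0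
  have hsad := hK d x ((le_max_left _ _).trans hdx) hd0 hx0 (by rw [hlogd]; field_simp; ring)
  rw [← hC₃re, ← hμdef] at hsad
  have hrate : C₁ * x ^ C₂ = μ * d := by
    rw [hC₁μ, hC₂μ, Real.rpow_def_of_pos hx0, mul_assoc, ← Real.exp_add, hd]
    congr 2
    field_simp
    ring
  rw [hD.deriv]
  calc ‖D‖ ≤ T * (x ^ (-d - 1) * ((a j * d + (B j).re) * √(a j * d + (B j).re)) *
          ∏ i, Real.Gamma (a i * d + (B i).re)) := hDle.trans (le_of_eq (by ring))
    _ ≤ T * Real.exp (K + (C₃.re + 1) * Real.log d - Real.log x - μ * d) := by gcongr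
    _ = T * Real.exp (K - (C₃.re + 1) * (S / μ)) * Real.exp (-C₁ * x ^ C₂) *
          x ^ (C₂ * C₃.re + (C₂ - 1)) := by
      rw [neg_mul, hrate, Real.rpow_def_of_pos hx0, mul_assoc, mul_assoc, ← Real.exp_add,
        ← Real.exp_add, hlogd, hC₂μ]
      congr 2
      field_simp
      ring
    _ ≤ _ := by
      gcongr
      rw [hC₄]
      exact le_max_right _ _

end
end

section
/- Let q ≥ 1, α = (α_1,…,α_q) with each α_i > 0, and β = (β_1,…,β_q) ∈ ℂ^q such that for each i either β_i = 0 or Re(β_i) > 0, and let j = #{1 ≤ i ≤ q : β_i = 0}. Let c < 0 be such that the function ∏_{i=1}^q Γ(α_i s + conj(β_i)) has no poles with Re(s) ∈ [c, 0), and let d > 0. Then for every x > 0, Z_{α,β}(x) = Z̃_{α,β}(x) − R(x), where R(x) is the residue at s = 0 of ∏_{i=1}^q Γ(α_i s + conj(β_i)) x^{−s}; explicitly, R(x) = 0 if j = 0, and R(x) = (1/(j−1)!) · lim_{s→0} (d/ds)^{j−1}[ s^{j} ∏_{i=1}^q Γ(α_i s + conj(β_i)) x^{−s} ] if j ≥ 1.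 -/
open Complex MeasureTheory Filter Topology Finset

noncomputable section

/-- The Gamma function on a vertical line in the right half-plane is largest on the real axis. -/
lemma norm_Gamma_le_Gamma_re_s17 {s : ℂ} (hs : 0 < s.re) : ‖Complex.Gamma s‖ ≤ Real.Gamma s.re := by
  rw [Complex.Gamma_eq_integral hs, Complex.GammaIntegral, Real.Gamma_eq_integral hs]
  refine (norm_integral_le_integral_norm _).trans_eq ?_
  refine setIntegral_congr_fun measurableSet_Ioi fun x hx => ?_
  have hx' : (0 : ℝ) < x := hx
  simp only [norm_mul, Complex.norm_real, Real.norm_eq_abs, Real.abs_exp,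
    Complex.norm_cpow_eq_rpow_re_of_pos hx', Complex.sub_re, Complex.one_re]

/-- Polynomial decay of the Gamma function, of any order, along vertical strips. -/
lemma exists_norm_Gamma_le_inv_im_pow (n : ℕ) : ∀ b : ℝ, ∃ C : ℝ, 0 ≤ C ∧
    ∀ s : ℂ, 1 - (n : ℝ) ≤ s.re → s.re ≤ b → s.im ≠ 0 →
      ‖Complex.Gamma s‖ ≤ C * (|s.im| ^ n)⁻¹ := by
  induction n with
  | zero =>
    intro b
    have hcont : ContinuousOn Real.Gamma (Set.Icc 1 b) := fun x hx =>
      (Real.differentiableAt_Gamma fun m h => by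
        have : (0 : ℝ) ≤ m := m.cast_nonneg
        linarith [hx.1]).continuousAt.continuousWithinAt
    obtain ⟨C, hC⟩ := isCompact_Icc.exists_bound_of_continuousOn hcont
    refine ⟨|C|, abs_nonneg _, fun s h1 h2 _ => ?_⟩
    simp only [Nat.cast_zero, sub_zero] at h1
    have := hC s.re ⟨h1, h2⟩
    have h3 := norm_Gamma_le_Gamma_re_s17 (s := s) (by linarith)
    simpa using h3.trans ((le_abs_self _).trans (this.trans (le_abs_self _)))
  | succ n ih =>
    intro b
    obtain ⟨C, hC0, hC⟩ := ih (b + 1)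
    refine ⟨C, hC0, fun s h1 h2 h3 => ?_⟩
    have hs : s ≠ 0 := fun h => h3 (by simp [h])
    push_cast at h1
    have := hC (s + 1) (by simp; linarith) (by simp; linarith) (by simpa using h3)
    rw [Complex.Gamma_add_one s hs, norm_mul] at this
    simp only [add_im, one_im, add_zero] at this
    have him : |s.im| ≤ ‖s‖ := Complex.abs_im_le_norm s
    have hpos : 0 < |s.im| := abs_pos.2 h3
    rw [pow_succ, mul_inv, ← mul_assoc, ← div_eq_mul_inv _ |s.im|, le_div_iff₀ hpos]
    refine le_trans ?_ this
    rw [mul_comm]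
    gcongr

lemma exists_norm_Gamma_linear_le {α : ℝ} (hα : 0 < α) (B : ℂ) (c d : ℝ) :
    ∃ C T : ℝ, 0 ≤ C ∧ ∀ s : ℂ, c ≤ s.re → s.re ≤ d → T ≤ |s.im| →
      ‖Complex.Gamma (α * s + B)‖ ≤ C * (s.im ^ 2)⁻¹ := by
  obtain ⟨n, hn⟩ := exists_nat_ge (max 2 (1 - (α * c + B.re)))
  have hn2 : 2 ≤ n := by exact_mod_cast (le_max_left _ _).trans hn
  have hn1 := (le_max_right _ _).trans hn
  obtain ⟨C, hC0, hC⟩ := exists_norm_Gamma_le_inv_im_pow n (α * d + B.re)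
  refine ⟨C * ((α / 2) ^ 2)⁻¹, (2 * |B.im| + 2) / α, by positivity, fun s h1 h2 h3 => ?_⟩
  have hT : 2 * |B.im| + 2 ≤ α * |s.im| := by
    rw [div_le_iff₀ hα] at h3; linarith
  have him : (α * s + B).im = α * s.im + B.im := by simp
  have hre : (α * s + B).re = α * s.re + B.re := by simp
  have hge : α / 2 * |s.im| + 1 ≤ |α * s.im + B.im| := by
    have := abs_sub_abs_le_abs_sub (α * s.im) (-B.im)
    rw [abs_neg, abs_mul, abs_of_pos hα, sub_neg_eq_add] at this
    linarith
  have hspos : 0 < |s.im| := lt_of_lt_of_le (by positivity) h3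
  have h1le : 1 ≤ |α * s.im + B.im| := le_trans (by nlinarith) hge
  have := hC (α * s + B) (by rw [hre]; nlinarith) (by rw [hre]; nlinarith)
    (by rw [him]; exact abs_pos.1 (by linarith))
  refine this.trans ?_
  rw [him, mul_assoc, ← mul_inv]
  have hs0 : s.im ≠ 0 := abs_pos.1 hspos
  gcongr
  calc (α / 2) ^ 2 * s.im ^ 2 = (α / 2 * |s.im|) ^ 2 := by rw [mul_pow, sq_abs]
    _ ≤ |α * s.im + B.im| ^ 2 := by gcongr; linarith
    _ ≤ _ := pow_le_pow_right₀ h1le hn2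

lemma exists_norm_prod_Gamma_mul_cpow_le {q : ℕ} (hq : 1 ≤ q) {α : Fin q → ℝ}
    (hα : ∀ i, 0 < α i) (B : Fin q → ℂ) {x : ℝ} (hx : 0 < x) (c d : ℝ) :
    ∃ C T : ℝ, 0 < T ∧ ∀ s : ℂ, c ≤ s.re → s.re ≤ d → T ≤ |s.im| →
      ‖(∏ i, Complex.Gamma (α i * s + B i)) * (x : ℂ) ^ (-s)‖ ≤ C * (s.im ^ 2)⁻¹ := by
  choose C T hC0 hC using fun i => exists_norm_Gamma_linear_le (hα i) (B i) c d
  have hcont : ContinuousOn (fun r : ℝ => x ^ (-r)) (Set.Icc c d) :=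
    (continuous_const.rpow continuous_neg fun _ => Or.inl hx.ne').continuousOn
  obtain ⟨M, hM⟩ := isCompact_Icc.exists_bound_of_continuousOn hcont
  refine ⟨(∏ i, C i) * M, 1 + ∑ i, |T i|, by positivity, fun s h1 h2 h3 => ?_⟩
  have hs1 : 1 ≤ |s.im| := le_trans (by simp; positivity) h3
  have hTi : ∀ i, T i ≤ |s.im| := fun i => by
    have := Finset.single_le_sum (f := fun i => |T i|) (fun i _ => abs_nonneg _)
      (Finset.mem_univ i)
    linarith [le_abs_self (T i)]
  have hinv : (s.im ^ 2)⁻¹ ≤ 1 := inv_le_one_of_one_le₀ (by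
    rw [← sq_abs]; exact one_le_pow₀ hs1)
  have hprod : ‖∏ i, Complex.Gamma (α i * s + B i)‖ ≤ (∏ i, C i) * (s.im ^ 2)⁻¹ := by
    rw [norm_prod]
    calc _ ≤ ∏ i, C i * (s.im ^ 2)⁻¹ :=
          Finset.prod_le_prod (fun _ _ => norm_nonneg _) fun i _ => hC i s h1 h2 (hTi i)
      _ = (∏ i, C i) * ((s.im ^ 2)⁻¹) ^ q := by simp [Finset.prod_mul_distrib]
      _ ≤ _ := by
          gcongr
          · exact Finset.prod_nonneg fun i _ => hC0 i
          · exact pow_le_of_le_one (by positivity) hinv (by omega)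
  have hxs : ‖(x : ℂ) ^ (-s)‖ ≤ M := by
    rw [Complex.norm_cpow_eq_rpow_re_of_pos hx, neg_re]
    exact (le_abs_self _).trans (hM s.re ⟨h1, h2⟩)
  rw [norm_mul]
  calc _ ≤ (∏ i, C i) * (s.im ^ 2)⁻¹ * M :=
        mul_le_mul hprod hxs (norm_nonneg _) ((norm_nonneg _).trans hprod)
    _ = _ := by ring

lemma ofReal_add_mul_I_ne_zero {a : ℝ} (ha : a ≠ 0) (t : ℝ) : (a : ℂ) + t * I ≠ 0 :=
  fun h => ha (by simpa using congrArg Complex.re h)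

lemma continuous_inv_line_pow {a : ℝ} (ha : a ≠ 0) (k : ℕ) :
    Continuous fun t : ℝ => (((a : ℂ) + t * I) ^ k)⁻¹ :=
  Continuous.inv₀ (by fun_prop) fun t => pow_ne_zero _ (ofReal_add_mul_I_ne_zero ha t)

lemma integral_inv_line {a : ℝ} (ha : a ≠ 0) (T : ℝ) :
    ∫ t in -T..T, ((a : ℂ) + t * I)⁻¹ = ((2 * Real.arctan (T / a) : ℝ) : ℂ) := by
  have hderiv : ∀ t : ℝ, HasDerivAt
      (fun t : ℝ => ((Real.arctan (t / a) : ℝ) : ℂ) -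
        I * ((Real.log (a ^ 2 + t ^ 2) / 2 : ℝ) : ℂ)) (((a : ℂ) + t * I)⁻¹) t := by
    intro t
    have hpos : a ^ 2 + t ^ 2 ≠ 0 := by positivity
    have h1 : HasDerivAt (fun t : ℝ => Real.arctan (t / a)) (a / (a ^ 2 + t ^ 2)) t := by
      refine ((hasDerivAt_id t).div_const a).arctan.congr_deriv ?_
      simp only [id]
      field_simp
    have h2 : HasDerivAt (fun t : ℝ => Real.log (a ^ 2 + t ^ 2) / 2) (t / (a ^ 2 + t ^ 2)) t := by
      refine ((((hasDerivAt_id t).pow 2).const_add (a ^ 2)).log hpos).div_const 2 |>.congr_deriv ?_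
      simp
      field_simp
    refine (h1.ofReal_comp.sub (h2.ofReal_comp.const_mul I)).congr_deriv ?_
    have hne := ofReal_add_mul_I_ne_zero ha t
    have hpos' : (a : ℂ) ^ 2 + (t : ℂ) ^ 2 ≠ 0 := by exact_mod_cast hpos
    push_cast
    field_simp
    linear_combination (-(t : ℂ) ^ 2) * I_sq
  rw [intervalIntegral.integral_eq_sub_of_hasDerivAt (fun t _ => hderiv t)]
  · simp only [neg_div, Real.arctan_neg, neg_sq]
    push_cast
    ring
  · simpa using (continuous_inv_line_pow ha 1).intervalIntegrable _ _

lemma tendsto_inv_line_pow (a : ℝ) (k : ℕ) {l : Filter ℝ} (hl : Tendsto (fun t => |t|) l atTop) :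
    Tendsto (fun t : ℝ => (((a : ℂ) + t * I) ^ (k + 1))⁻¹) l (𝓝 0) := by
  refine tendsto_inv₀_cobounded.comp (tendsto_norm_atTop_iff_cobounded.1 ?_)
  simp only [norm_pow]
  refine (tendsto_pow_atTop k.succ_ne_zero).comp (tendsto_atTop_mono (fun t => ?_) hl)
  simpa using Complex.abs_im_le_norm ((a : ℂ) + t * I)

lemma tendsto_integral_inv_line_pow {a : ℝ} (ha : a ≠ 0) (k : ℕ) :
    Tendsto (fun T : ℝ => ∫ t in -T..T, (((a : ℂ) + t * I) ^ (k + 2))⁻¹) atTop (𝓝 0) := by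
  have hderiv : ∀ t : ℝ, HasDerivAt
      (fun t : ℝ => -(((k : ℂ) + 1) * I)⁻¹ * (((a : ℂ) + t * I) ^ (k + 1))⁻¹)
      ((((a : ℂ) + t * I) ^ (k + 2))⁻¹) t := by
    intro t
    have hne := ofReal_add_mul_I_ne_zero ha t
    have h1 : HasDerivAt (fun t : ℝ => (a : ℂ) + t * I) I t := by
      simpa using (((hasDerivAt_id t).ofReal_comp).mul_const I).const_add (a : ℂ)
    have hk : (k : ℂ) + 1 ≠ 0 := by exact_mod_cast k.succ_ne_zero
    refine (((h1.pow (k + 1)).inv (pow_ne_zero _ hne)).const_mul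
      (-(((k : ℂ) + 1) * I)⁻¹)).congr_deriv ?_
    simp only [Nat.add_sub_cancel, Nat.cast_add, Nat.cast_one, Pi.pow_apply]
    generalize (a : ℂ) + t * I = w at hne
    field_simp
    ring
  have heq : ∀ T : ℝ, ∫ t in -T..T, (((a : ℂ) + t * I) ^ (k + 2))⁻¹ =
      -(((k : ℂ) + 1) * I)⁻¹ * (((a : ℂ) + T * I) ^ (k + 1))⁻¹ -
      -(((k : ℂ) + 1) * I)⁻¹ * (((a : ℂ) + (-T : ℝ) * I) ^ (k + 1))⁻¹ := fun T =>
    intervalIntegral.integral_eq_sub_of_hasDerivAt (fun t _ => hderiv t)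
      ((continuous_inv_line_pow ha _).intervalIntegrable _ _)
  simp only [heq]
  have h1 := (tendsto_inv_line_pow a k tendsto_abs_atTop_atTop).const_mul (-(((k : ℂ) + 1) * I)⁻¹)
  have h2 := ((tendsto_inv_line_pow a k tendsto_abs_atBot_atTop).comp
    tendsto_neg_atTop_atBot).const_mul (-(((k : ℂ) + 1) * I)⁻¹)
  simpa using h1.sub h2

/-- The truncated vertical integrals of `s ^ (-(m + 1))` on two lines enclosing the origin differ
in the limit by `2π` times its residue at the origin. -/
lemma tendsto_vertical_sub_inv_pow {c d : ℝ} (hc : c < 0) (hd : 0 < d) (m : ℕ) :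
    Tendsto (fun T : ℝ => (∫ t in -T..T, (((d : ℂ) + t * I) ^ (m + 1))⁻¹) -
      ∫ t in -T..T, (((c : ℂ) + t * I) ^ (m + 1))⁻¹) atTop
      (𝓝 (if m = 0 then 2 * (Real.pi : ℂ) else 0)) := by
  rcases m with _ | m
  · simp only [zero_add, pow_one, if_true, integral_inv_line hd.ne', integral_inv_line hc.ne]
    have h1 : Tendsto (fun T : ℝ => Real.arctan (T / d)) atTop (𝓝 (Real.pi / 2)) :=
      (tendsto_nhds_of_tendsto_nhdsWithin Real.tendsto_arctan_atTop).comp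
        (tendsto_id.atTop_div_const hd)
    have h2 : Tendsto (fun T : ℝ => Real.arctan (T / c)) atTop (𝓝 (-(Real.pi / 2))) :=
      (tendsto_nhds_of_tendsto_nhdsWithin Real.tendsto_arctan_atBot).comp
        (tendsto_id.atTop_div_const_of_neg hc)
    have h3 := (Complex.continuous_ofReal.tendsto _).comp
      ((h1.const_mul 2).sub (h2.const_mul 2))
    convert h3 using 2
    · simp
    · push_cast; ring
  · simpa using (tendsto_integral_inv_line_pow hd.ne' m).sub
      (tendsto_integral_inv_line_pow hc.ne m)

/-- Cauchy's theorem for a closed vertical strip: the integrals of a decaying holomorphic function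
along the two sides, truncated at height `T`, agree in the limit. -/
lemma tendsto_vertical_sub_of_differentiableAt {c d : ℝ} (hcd : c ≤ d) {h : ℂ → ℂ}
    (hdiff : ∀ s : ℂ, c ≤ s.re → s.re ≤ d → DifferentiableAt ℂ h s) {K T₀ : ℝ}
    (hbound : ∀ s : ℂ, c ≤ s.re → s.re ≤ d → T₀ ≤ |s.im| → ‖h s‖ ≤ K * |s.im|⁻¹) :
    Tendsto (fun T : ℝ => (∫ t in -T..T, h ((d : ℂ) + t * I)) -
      ∫ t in -T..T, h ((c : ℂ) + t * I)) atTop (𝓝 0) := by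
  have hlim : Tendsto (fun T : ℝ => 2 * (K * |T|⁻¹ * |d - c|)) atTop (𝓝 0) := by
    simpa using (((tendsto_inv_atTop_zero.comp tendsto_abs_atTop_atTop).const_mul K).mul_const
      |d - c|).const_mul 2
  refine squeeze_zero_norm' ?_ hlim
  filter_upwards [eventually_ge_atTop (max T₀ 0)] with T hT
  have hT0 : T₀ ≤ |T| := (le_max_left _ _).trans (hT.trans (le_abs_self T))
  have hrect := Complex.integral_boundary_rect_eq_zero_of_differentiableOn h
    ((c : ℂ) + (-T : ℝ) * I) ((d : ℂ) + (T : ℝ) * I) (fun s hs => by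
      have := hs.1
      simp only [Set.mem_preimage, add_re, ofReal_re, mul_re, I_re, ofReal_im, I_im, mul_zero,
        mul_one, sub_zero, add_zero, Set.uIcc_of_le hcd] at this
      exact (hdiff s this.1 this.2).differentiableWithinAt)
  simp only [add_re, ofReal_re, mul_re, I_re, ofReal_im, I_im, mul_zero, mul_one, sub_zero,
    add_zero, add_im, mul_im, zero_add, smul_eq_mul] at hrect
  have hhor : ∀ y : ℝ, |y| = |T| → ‖∫ r in c..d, h ((r : ℂ) + (y : ℝ) * I)‖ ≤
      K * |T|⁻¹ * |d - c| := by
    intro y hy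
    refine intervalIntegral.norm_integral_le_of_norm_le_const fun r hr => ?_
    rw [Set.uIoc_of_le hcd] at hr
    simpa [hy] using hbound ((r : ℂ) + (y : ℝ) * I) (by simpa using hr.1.le)
      (by simpa using hr.2) (by simpa [hy] using hT0)
  have h1 := hhor (-T) (abs_neg T)
  have h2 := hhor T rfl
  have heq : (∫ t in -T..T, h ((d : ℂ) + t * I)) - ∫ t in -T..T, h ((c : ℂ) + t * I) =
      I * ((∫ r in c..d, h ((r : ℂ) + (-T : ℝ) * I)) - ∫ r in c..d, h ((r : ℂ) + (T : ℝ) * I)) := by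
    linear_combination (-I) * hrect + ((∫ t in -T..T, h ((d : ℂ) + t * I)) -
      ∫ t in -T..T, h ((c : ℂ) + t * I)) * I_sq
  rw [heq, norm_mul, norm_I, one_mul]
  linarith [norm_sub_le (∫ r in c..d, h ((r : ℂ) + (-T : ℝ) * I))
    (∫ r in c..d, h ((r : ℂ) + (T : ℝ) * I))]

lemma integrable_of_norm_le_inv_sq {f : ℝ → ℂ} (hf : Continuous f) {C T : ℝ} (hT : 0 < T)
    (hbound : ∀ t : ℝ, T ≤ |t| → ‖f t‖ ≤ C * (t ^ 2)⁻¹) : Integrable f := by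
  have hO : f =O[cocompact ℝ] fun t : ℝ => (1 + t ^ 2)⁻¹ := by
    refine Asymptotics.IsBigO.of_bound (|C| * (1 + (T ^ 2)⁻¹)) ?_
    filter_upwards [(tendsto_norm_cocompact_atTop (E := ℝ)).eventually_ge_atTop T] with t ht
    rw [Real.norm_eq_abs] at ht
    have hsq : T ^ 2 ≤ t ^ 2 := by rw [← sq_abs t]; gcongr
    have ht2 : 0 < t ^ 2 := lt_of_lt_of_le (by positivity) hsq
    have hkey : (t ^ 2)⁻¹ ≤ (1 + (T ^ 2)⁻¹) * (1 + t ^ 2)⁻¹ := by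
      rw [← div_eq_mul_inv, le_div_iff₀ (by positivity)]
      have : (t ^ 2)⁻¹ ≤ (T ^ 2)⁻¹ := by gcongr
      rw [mul_add, inv_mul_cancel₀ ht2.ne']
      linarith
    rw [Real.norm_of_nonneg (by positivity)]
    calc ‖f t‖ ≤ C * (t ^ 2)⁻¹ := hbound t ht
      _ ≤ |C| * ((1 + (T ^ 2)⁻¹) * (1 + t ^ 2)⁻¹) := by
          gcongr
          exact le_abs_self C
      _ = _ := by ring
  exact hf.locallyIntegrable.integrable_of_isBigO_cocompact hO
    (integrable_inv_one_add_sq.integrableAtFilter _)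

/-- Shifting a vertical contour across the origin, where `f` has the principal part
`∑ b m * s ^ (-(m + 1))` and no other singularity in the closed strip. -/
lemma integral_line_sub_integral_line {c d : ℝ} (hc : c < 0) (hd : 0 < d) {f H : ℂ → ℂ}
    (hdiff : ∀ s : ℂ, c ≤ s.re → s.re ≤ d → s ≠ 0 → DifferentiableAt ℂ f s) {C T₀ : ℝ}
    (hT₀ : 0 < T₀)
    (hbound : ∀ s : ℂ, c ≤ s.re → s.re ≤ d → T₀ ≤ |s.im| → ‖f s‖ ≤ C * (s.im ^ 2)⁻¹)
    (j : ℕ) (b : ℕ → ℂ) (hH : AnalyticAt ℂ H 0)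
    (hf : ∀ᶠ s in 𝓝[≠] (0 : ℂ), f s = ∑ m ∈ Finset.range j, b m * (s ^ (m + 1))⁻¹ + H s) :
    (∫ t : ℝ, f ((d : ℂ) + t * I)) - ∫ t : ℝ, f ((c : ℂ) + t * I) =
      ∑ m ∈ Finset.range j, b m * (if m = 0 then 2 * (Real.pi : ℂ) else 0) := by
  set P : ℂ → ℂ := fun s => ∑ m ∈ Finset.range j, b m * (s ^ (m + 1))⁻¹ with hP
  set h : ℂ → ℂ := Function.update (fun s => f s - P s) 0 (H 0) with hh
  have hcd : c ≤ d := (hc.trans hd).le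
  have hne : ∀ s : ℂ, s ≠ 0 → h s = f s - P s := fun s hs => by simp [hh, hs]
  have hhH : h =ᶠ[𝓝 0] H := by
    rw [eventually_nhdsWithin_iff] at hf
    filter_upwards [hf] with s hs
    by_cases h0 : s = 0
    · simp [hh, h0]
    · rw [hne s h0, hs h0]; ring
  have hPdiff : ∀ s : ℂ, s ≠ 0 → DifferentiableAt ℂ P s := fun s hs =>
    DifferentiableAt.fun_sum fun m _ =>
      ((differentiableAt_id.pow (m + 1)).inv (pow_ne_zero _ hs)).const_mul (b m)
  have hhdiff : ∀ s : ℂ, c ≤ s.re → s.re ≤ d → DifferentiableAt ℂ h s := by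
    intro s h1 h2
    by_cases h0 : s = 0
    · rw [h0]
      exact hH.differentiableAt.congr_of_eventuallyEq hhH
    · refine ((hdiff s h1 h2 h0).sub (hPdiff s h0)).congr_of_eventuallyEq ?_
      filter_upwards [isOpen_ne.mem_nhds h0] with z hz using hne z hz
  have hhbound : ∀ s : ℂ, c ≤ s.re → s.re ≤ d → max T₀ 1 ≤ |s.im| →
      ‖h s‖ ≤ (|C| + ∑ m ∈ Finset.range j, ‖b m‖) * |s.im|⁻¹ := by
    intro s h1 h2 h3
    have h31 : 1 ≤ |s.im| := (le_max_right _ _).trans h3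
    have hpos : 0 < |s.im| := one_pos.trans_le h31
    have hs0 : s ≠ 0 := fun h => by simp [h] at hpos
    rw [hne s hs0, add_mul]
    refine (norm_sub_le _ _).trans (add_le_add ?_ ?_)
    · calc ‖f s‖ ≤ C * (s.im ^ 2)⁻¹ := hbound s h1 h2 ((le_max_left _ _).trans h3)
        _ ≤ |C| * |s.im|⁻¹ := by
          rw [← sq_abs]
          gcongr
          · exact le_abs_self C
          · exact le_self_pow₀ h31 two_ne_zero
    · rw [hP, Finset.sum_mul]
      refine (norm_sum_le _ _).trans (Finset.sum_le_sum fun m _ => ?_)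
      rw [norm_mul, norm_inv, norm_pow]
      gcongr
      calc |s.im| ≤ |s.im| ^ (m + 1) := le_self_pow₀ h31 m.succ_ne_zero
        _ ≤ ‖s‖ ^ (m + 1) := by gcongr; exact Complex.abs_im_le_norm s
  have hhlim := tendsto_vertical_sub_of_differentiableAt hcd hhdiff hhbound
  have hfcont : ∀ a : ℝ, c ≤ a → a ≤ d → a ≠ 0 → Continuous fun t : ℝ => f ((a : ℂ) + t * I) := by
    intro a h1 h2 h0
    refine continuous_iff_continuousAt.2 fun t => ?_
    have hfa := (hdiff ((a : ℂ) + t * I) (by simpa using h1) (by simpa using h2)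
      (ofReal_add_mul_I_ne_zero h0 t)).continuousAt
    exact ContinuousAt.comp (f := fun t : ℝ => (a : ℂ) + t * I) hfa (by fun_prop)
  have hflim : ∀ a : ℝ, c ≤ a → a ≤ d → a ≠ 0 →
      Tendsto (fun T : ℝ => ∫ t in -T..T, f ((a : ℂ) + t * I)) atTop
        (𝓝 (∫ t : ℝ, f ((a : ℂ) + t * I))) := by
    intro a h1 h2 h0
    refine intervalIntegral_tendsto_integral ?_ tendsto_neg_atTop_atBot tendsto_id
    refine integrable_of_norm_le_inv_sq (hfcont a h1 h2 h0) hT₀ (C := C) fun t ht => ?_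
    simpa using hbound ((a : ℂ) + t * I) (by simpa using h1) (by simpa using h2)
      (by simpa using ht)
  have hfint := (hflim d hcd le_rfl hd.ne').sub (hflim c le_rfl hcd hc.ne)
  have hPint : Tendsto (fun T : ℝ => ∑ m ∈ Finset.range j,
      b m * ((∫ t in -T..T, (((d : ℂ) + t * I) ^ (m + 1))⁻¹) -
        ∫ t in -T..T, (((c : ℂ) + t * I) ^ (m + 1))⁻¹)) atTop
      (𝓝 (∑ m ∈ Finset.range j, b m * (if m = 0 then 2 * (Real.pi : ℂ) else 0))) :=
    tendsto_finsetSum _ fun m _ => (tendsto_vertical_sub_inv_pow hc hd m).const_mul (b m)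
  have hsplit : ∀ (a : ℝ), c ≤ a → a ≤ d → a ≠ 0 → ∀ T : ℝ,
      ∫ t in -T..T, h ((a : ℂ) + t * I) = (∫ t in -T..T, f ((a : ℂ) + t * I)) -
        ∑ m ∈ Finset.range j, b m * ∫ t in -T..T, (((a : ℂ) + t * I) ^ (m + 1))⁻¹ := by
    intro a h1 h2 h0 T
    have hci : ∀ m ∈ Finset.range j, IntervalIntegrable
        (fun t : ℝ => b m * (((a : ℂ) + t * I) ^ (m + 1))⁻¹) volume (-T) T := fun m _ =>
      ((continuous_inv_line_pow h0 (m + 1)).const_mul (b m)).intervalIntegrable _ _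
    simp only [hne _ (ofReal_add_mul_I_ne_zero h0 _), hP]
    rw [intervalIntegral.integral_sub ((hfcont a h1 h2 h0).intervalIntegrable _ _)
      (by simpa only [Finset.sum_fn] using IntervalIntegrable.sum (Finset.range j) hci),
      intervalIntegral.integral_finsetSum hci]
    simp only [intervalIntegral.integral_const_mul]
  refine sub_eq_zero.1 (tendsto_nhds_unique (hfint.sub hPint) (hhlim.congr fun T => ?_))
  rw [hsplit d hcd le_rfl hd.ne', hsplit c le_rfl hcd hc.ne]
  simp only [mul_sub, Finset.sum_sub_distrib]
  ring

lemma linear_ne_neg_nat {a : ℝ} (ha : 0 < a) {β s : ℂ} (hβ : β = 0 ∨ 0 < β.re)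
    (hneg : s.re < 0 → ∀ n : ℕ, (a : ℂ) * s + (starRingEnd ℂ) β ≠ -(n : ℂ))
    (h0 : s ≠ 0 ∨ β ≠ 0) (n : ℕ) : (a : ℂ) * s + (starRingEnd ℂ) β ≠ -(n : ℂ) := by
  rcases lt_or_ge s.re 0 with hs | hs
  · exact hneg hs n
  · intro h
    have hre : a * s.re + β.re = -(n : ℝ) := by simpa using congrArg Complex.re h
    have hn : (0 : ℝ) ≤ n := n.cast_nonneg
    have has : 0 ≤ a * s.re := mul_nonneg ha.le hs
    rcases hβ with rfl | hβ
    · have hs0 : s ≠ 0 := h0.resolve_right (by simp)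
      have him : a * s.im = 0 := by simpa using congrArg Complex.im h
      rw [Complex.zero_re] at hre
      have hre0 : a * s.re = 0 := by linarith
      exact hs0 (Complex.ext (by simpa using (mul_eq_zero.1 hre0).resolve_left ha.ne')
        (by simpa using (mul_eq_zero.1 him).resolve_left ha.ne'))
    · linarith

lemma differentiableAt_prod_Gamma_mul_cpow {q : ℕ} {α : Fin q → ℝ} {B : Fin q → ℂ} {x : ℝ}
    (hx : 0 < x) {s : ℂ} (hs : ∀ i, ∀ n : ℕ, (α i : ℂ) * s + B i ≠ -(n : ℂ)) :
    DifferentiableAt ℂ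
      (fun s => (∏ i, Complex.Gamma ((α i : ℂ) * s + B i)) * (x : ℂ) ^ (-s)) s := by
  refine DifferentiableAt.mul (DifferentiableAt.fun_finsetProd fun i _ => ?_) ?_
  · exact (Complex.differentiableAt_Gamma _ (hs i)).comp s
      ((differentiableAt_id.const_mul (α i : ℂ)).add_const (B i))
  · exact differentiableAt_id.neg.const_cpow (Or.inl (by exact_mod_cast hx.ne'))

/-- Contour-shift relation `Z_{α,β}(x) = Z̃_{α,β}(x) - Res_{s=0} ∏ Γ(αᵢ s + conj βᵢ) x^{-s}`,
the residue being `0` if `j = 0` and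
`(1/(j-1)!) lim_{s→0} (d/ds)^{j-1}[s^j ∏ Γ(αᵢ s + conj βᵢ) x^{-s}]` if `j ≥ 1`. -/
theorem statement17 (q : ℕ) (hq : 1 ≤ q) (α : Fin q → ℝ) (hα : ∀ i, 0 < α i)
    (β : Fin q → ℂ) (hβ : ∀ i, β i = 0 ∨ 0 < (β i).re)
    (j : ℕ) (hj : j = (Finset.univ.filter fun i => β i = 0).card)
    (c : ℝ) (hc : c < 0)
    (hnopole : ∀ s : ℂ, c ≤ s.re → s.re < 0 → ∀ i, ∀ n : ℕ,
      (α i : ℂ) * s + (starRingEnd ℂ) (β i) ≠ -(n : ℂ))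
    (d : ℝ) (hd : 0 < d) :
    ∀ x : ℝ, 0 < x →
      (j = 0 →
        VI α (fun i => (starRingEnd ℂ) (β i)) c x =
          VI α (fun i => (starRingEnd ℂ) (β i)) d x) ∧
      (1 ≤ j → ∀ G : ℂ → ℂ, AnalyticAt ℂ G 0 →
        (∀ᶠ s in 𝓝[≠] (0 : ℂ), G s =
          s ^ j * (∏ i, Complex.Gamma ((α i : ℂ) * s + (starRingEnd ℂ) (β i))) *
            (x : ℂ) ^ (-s)) →
        VI α (fun i => (starRingEnd ℂ) (β i)) c x =
          VI α (fun i => (starRingEnd ℂ) (β i)) d x -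
            (1 / ((j - 1).factorial : ℂ)) * iteratedDeriv (j - 1) G 0) := by
  intro x hx
  set B : Fin q → ℂ := fun i => (starRingEnd ℂ) (β i)
  set f : ℂ → ℂ := fun s => (∏ i, Complex.Gamma ((α i : ℂ) * s + B i)) * (x : ℂ) ^ (-s)
  obtain ⟨C, T, hT, hbound⟩ := exists_norm_prod_Gamma_mul_cpow_le hq hα B hx c d
  have hreg : ∀ s : ℂ, c ≤ s.re → (s ≠ 0 ∨ ∀ i, β i ≠ 0) → DifferentiableAt ℂ f s :=
    fun s h1 h2 => differentiableAt_prod_Gamma_mul_cpow hx fun i n =>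
      linear_ne_neg_nat (hα i) (hβ i) (fun h => hnopole s h1 h i) (h2.imp_right fun h => h i) n
  have hVI : VI α B d x - VI α B c x = (2 * (Real.pi : ℂ))⁻¹ *
      ((∫ t : ℝ, f ((d : ℂ) + t * I)) - ∫ t : ℝ, f ((c : ℂ) + t * I)) := by
    have hline : ∀ a : ℝ, VI α B a x =
        (2 * (Real.pi : ℂ))⁻¹ * ∫ t : ℝ, f ((a : ℂ) + t * I) := fun a => by
      rw [VI, integral_const_mul, mul_inv, mul_assoc, ← mul_assoc I⁻¹, inv_mul_cancel₀ I_ne_zero,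
        one_mul]
    rw [hline, hline, mul_sub]
  have hpi : (Real.pi : ℂ) ≠ 0 := by exact_mod_cast Real.pi_ne_zero
  constructor
  · intro hj0
    have hβ0 : ∀ i, β i ≠ 0 := by
      simpa [Finset.filter_eq_empty_iff] using hj.symm.trans hj0
    have hfan : AnalyticAt ℂ f 0 := by
      refine Complex.analyticAt_iff_eventually_differentiableAt.2 ?_
      filter_upwards [(isOpen_lt continuous_const Complex.continuous_re).mem_nhds
        (show c < (0 : ℂ).re by simpa using hc)] with s hs
      exact hreg s (le_of_lt hs) (Or.inr hβ0)
    have hint := integral_line_sub_integral_line hc hd (fun s h1 _ h0 => hreg s h1 (Or.inl h0))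
      hT hbound 0 0 hfan (by simp)
    rw [hint] at hVI
    exact (sub_eq_zero.1 (hVI.trans (by simp))).symm
  · intro hj1 G hG hGf
    obtain ⟨H, hH, hGH⟩ := hG.exists_eq_sum_add_pow_mul j
    have hint := integral_line_sub_integral_line hc hd (fun s h1 _ h0 => hreg s h1 (Or.inl h0))
      hT hbound j (fun m => iteratedDeriv (j - 1 - m) G 0 / (j - 1 - m).factorial) hH (by
        filter_upwards [hGf, self_mem_nhdsWithin] with s hs h0
        have h0' : s ≠ 0 := h0
        have hfs : f s = G s * (s ^ j)⁻¹ := by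
          rw [hs, mul_comm, mul_assoc (s ^ j), inv_mul_cancel_left₀ (pow_ne_zero j h0')]
        rw [hfs, hGH s, add_mul, Finset.sum_mul, ← Finset.sum_range_reflect]
        congr 1
        · refine Finset.sum_congr rfl fun m hm => ?_
          have hm' : m < j := Finset.mem_range.1 hm
          have hpow : s ^ j = s ^ (j - 1 - m) * s ^ (m + 1) := by
            rw [← pow_add]; congr 1; omega
          rw [hpow, smul_eq_mul]
          field_simp
        · rw [smul_eq_mul]
          field_simp)
    have hsum : ∑ m ∈ Finset.range j, iteratedDeriv (j - 1 - m) G 0 / (j - 1 - m).factorial *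
        (if m = 0 then 2 * (Real.pi : ℂ) else 0) =
        iteratedDeriv (j - 1) G 0 / (j - 1).factorial * (2 * (Real.pi : ℂ)) := by
      rw [Finset.sum_eq_single_of_mem 0 (Finset.mem_range.2 hj1) fun m _ hm => by simp [hm]]
      simp
    rw [hint, hsum] at hVI
    have hres : (2 * (Real.pi : ℂ))⁻¹ *
        (iteratedDeriv (j - 1) G 0 / (j - 1).factorial * (2 * (Real.pi : ℂ))) =
        1 / ((j - 1).factorial : ℂ) * iteratedDeriv (j - 1) G 0 := by
      field_simp
    rw [hres] at hVI
    linear_combination -hVI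

end
end
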